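/- arXiv:2204.03878 — 13 statements merged into one kernel-verified Lean document; each statement's English description precedes it below -/
import Mathlib

section
/- The relation ≼_W is a linear (total) order on the set 𝒫 of all picture fuzzy numbers: it is reflexive, antisymmetric, transitive, and any two PFNs are comparable. In particular, if two PFNs α and β satisfy S(α) = S(β), H₁(α) = H₁(β), and H₂(α) = H₂(β), then α = β. -/
open scoped ENNReal

/-- A picture fuzzy number (PFN): a triple of reals in `[0,1]` whose sum is at most `1`. -/
structure PFN where
  mu : ℝ
  eta : ℝ
  nu : ℝ
  mu_nonneg : 0 ≤ mu
  mu_le_one : mu ≤ 1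
  eta_nonneg : 0 ≤ eta
  eta_le_one : eta ≤ 1
  nu_nonneg : 0 ≤ nu
  nu_le_one : nu ≤ 1
  sum_le_one : mu + eta + nu ≤ 1

/-- The underlying triple of a PFN. -/
def PFN.toProd (a : PFN) : ℝ × ℝ × ℝ := (a.mu, a.eta, a.nu)

/-- A triple of reals satisfies the PFN conditions: all three components lie in `[0,1]`
and their sum is at most `1`. -/
def isPFN (t : ℝ × ℝ × ℝ) : Prop :=
  0 ≤ t.1 ∧ t.1 ≤ 1 ∧ 0 ≤ t.2.1 ∧ t.2.1 ≤ 1 ∧ 0 ≤ t.2.2 ∧ t.2.2 ≤ 1 ∧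
    t.1 + t.2.1 + t.2.2 ≤ 1

/-- Score function `S(α) = μ - ν`. -/
def PFN.score (a : PFN) : ℝ := a.mu - a.nu

/-- First accuracy function `H₁(α) = μ + ν`. -/
def PFN.H1 (a : PFN) : ℝ := a.mu + a.nu

/-- Second accuracy function `H₂(α) = μ + η + ν`. -/
def PFN.H2 (a : PFN) : ℝ := a.mu + a.eta + a.nu

/-- The order `≼_W` on PFNs. -/
def PFN.leW (a b : PFN) : Prop :=
  a.score < b.score ∨
    (a.score = b.score ∧ a.H1 < b.H1) ∨
    (a.score = b.score ∧ a.H1 = b.H1 ∧ a.H2 ≤ b.H2)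

/-- A picture fuzzy number is determined by its score and its two accuracies. -/
theorem PFN.eq_of_score_eq_of_H1_eq_of_H2_eq {a b : PFN} (hS : a.score = b.score)
    (h₁ : a.H1 = b.H1) (h₂ : a.H2 = b.H2) : a = b := by
  simp only [PFN.score, PFN.H1, PFN.H2] at hS h₁ h₂
  cases a
  cases b
  simp only [PFN.mk.injEq] at *
  refine ⟨?_, ?_, ?_⟩ <;> linarith

/-- `≼_W` is a linear order on the set of all PFNs: reflexive, antisymmetric, transitive,
and total; in particular two PFNs with the same score and accuracy values are equal. -/
theorem leW_isLinearOrder :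
    (∀ a : PFN, a.leW a) ∧
    (∀ a b : PFN, a.leW b → b.leW a → a = b) ∧
    (∀ a b c : PFN, a.leW b → b.leW c → a.leW c) ∧
    (∀ a b : PFN, a.leW b ∨ b.leW a) ∧
    (∀ a b : PFN, a.score = b.score → a.H1 = b.H1 → a.H2 = b.H2 → a = b) := by
  refine ⟨fun a => ?_, fun a b hab hba => ?_, fun a b c hab hbc => ?_, fun a b => ?_,
    fun a b => PFN.eq_of_score_eq_of_H1_eq_of_H2_eq⟩
  · exact Or.inr (Or.inr ⟨rfl, rfl, le_rfl⟩)
  · unfold PFN.leW at hab hba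
    apply PFN.eq_of_score_eq_of_H1_eq_of_H2_eq <;> grind
  · unfold PFN.leW at *
    grind
  · unfold PFN.leW
    grind
end

section
/- The order ≼_W on the set 𝒫 of picture fuzzy numbers is admissible: for any two PFNs α and β, if α ⊆ β (that is, μ_α ≤ μ_β, η_α ≤ η_β, and ν_α ≥ ν_β), then α ≼_W β. -/
open scoped ENNReal

/-- `≼_W` is an admissible order: it refines the partial order `⊆` on PFNs. -/
theorem leW_admissible (a b : PFN)
    (hmu : a.mu ≤ b.mu) (heta : a.eta ≤ b.eta) (hnu : b.nu ≤ a.nu) :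
    a.leW b := by
  simp only [PFN.leW, PFN.score, PFN.H1, PFN.H2]
  rcases (sub_le_sub hmu hnu).lt_or_eq with h | h
  · exact Or.inl h
  · exact Or.inr (Or.inr ⟨h, by linarith, by linarith⟩)
end

section
/- The poset (𝒫, ≼_W) of all picture fuzzy numbers under the order ≼_W is a complete lattice: every subset of 𝒫 has a least upper bound and a greatest lower bound in 𝒫 with respect to ≼_W. In particular ⟨0,0,1⟩ is the bottom element and ⟨1,0,0⟩ is the top element. -/
open scoped ENNReal

/-- The PFN `⟨0,0,1⟩`. -/
def PFN.bot : PFN :=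
  ⟨0, 0, 1, le_refl 0, zero_le_one, le_refl 0, zero_le_one, zero_le_one, le_refl 1,
    by norm_num⟩

/-- The PFN `⟨1,0,0⟩`. -/
def PFN.top : PFN :=
  ⟨1, 0, 0, zero_le_one, le_refl 1, le_refl 0, zero_le_one, le_refl 0, zero_le_one,
    by norm_num⟩

theorem Real.exists_isLUB_insert {b c : ℝ} {T : Set ℝ} (hb : b ≤ c) (hT : ∀ x ∈ T, x ≤ c) :
    ∃ x, IsLUB (insert b T) x ∧ b ≤ x ∧ x ≤ c := by
  have hc : c ∈ upperBounds (insert b T) := by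
    rintro x (rfl | hx)
    exacts [hb, hT x hx]
  obtain ⟨x, hx⟩ := Real.exists_isLUB (Set.insert_nonempty b T) ⟨c, hc⟩
  exact ⟨x, hx, hx.1 (Set.mem_insert b T), hx.2 hc⟩

namespace PFN

theorem neg_one_le_score (a : PFN) : -1 ≤ a.score := by
  have := a.mu_nonneg
  have := a.nu_le_one
  unfold score
  linarith

theorem score_le_one (a : PFN) : a.score ≤ 1 := by
  have := a.mu_le_one
  have := a.nu_nonneg
  unfold score
  linarith

theorem abs_score_le_H1 (a : PFN) : |a.score| ≤ a.H1 := by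
  have := a.mu_nonneg
  have := a.nu_nonneg
  unfold score H1
  rw [abs_le]
  constructor <;> linarith

theorem H1_le_H2 (a : PFN) : a.H1 ≤ a.H2 := by
  have := a.eta_nonneg
  unfold H1 H2
  linarith

theorem H2_le_one (a : PFN) : a.H2 ≤ 1 := a.sum_le_one

theorem H1_le_one (a : PFN) : a.H1 ≤ 1 := a.H1_le_H2.trans a.H2_le_one

theorem exists_score_H1_H2 {s h t : ℝ} (hs : |s| ≤ h) (hh : h ≤ t) (ht : t ≤ 1) :
    ∃ a : PFN, a.score = s ∧ a.H1 = h ∧ a.H2 = t := by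
  obtain ⟨hs₁, hs₂⟩ := abs_le.1 hs
  refine ⟨⟨(h + s) / 2, t - h, (h - s) / 2, ?_, ?_, ?_, ?_, ?_, ?_, ?_⟩, ?_, ?_, ?_⟩
  case refine_8 | refine_9 | refine_10 => simp only [score, H1, H2]; ring
  all_goals linarith

theorem leW_of_le {a b : PFN} (hs : a.score ≤ b.score)
    (h₁ : a.score = b.score → a.H1 ≤ b.H1)
    (h₂ : a.score = b.score → a.H1 = b.H1 → a.H2 ≤ b.H2) : a.leW b := by
  unfold leW
  grind

theorem leW.score_le {a b : PFN} (h : a.leW b) : a.score ≤ b.score := by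
  unfold leW at h
  grind

theorem leW.H1_le {a b : PFN} (h : a.leW b) (hs : a.score = b.score) : a.H1 ≤ b.H1 := by
  unfold leW at h
  grind

theorem leW.H2_le {a b : PFN} (h : a.leW b) (hs : a.score = b.score) (h₁ : a.H1 = b.H1) :
    a.H2 ≤ b.H2 := by
  unfold leW at h
  grind

theorem bot_leW (a : PFN) : bot.leW a := by
  have hs : bot.score = -1 := by norm_num [score, bot]
  have h₁ : bot.H1 = 1 := by norm_num [H1, bot]
  have h₂ : bot.H2 = 1 := by norm_num [H2, bot]
  have ha := a.abs_score_le_H1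
  have ha' := a.H1_le_H2
  apply leW_of_le
  · exact hs ▸ a.neg_one_le_score
  · intro h
    rw [← h, hs] at ha
    norm_num at ha
    linarith
  · intro _ h
    linarith

theorem leW_top (a : PFN) : a.leW top := by
  have hs : top.score = 1 := by norm_num [score, top]
  have h₁ : top.H1 = 1 := by norm_num [H1, top]
  have h₂ : top.H2 = 1 := by norm_num [H2, top]
  apply leW_of_le
  · exact hs ▸ a.score_le_one
  · exact fun _ => h₁ ▸ a.H1_le_one
  · exact fun _ _ => h₂ ▸ a.H2_le_one

/-- The least upper bound is built lexicographically: first the supremum `s` of the scores, then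
that of `H₁` over the elements of score `s`, then that of `H₂` over the elements attaining both.
Where nothing attains the earlier suprema, the smallest admissible value is taken. -/
theorem exists_leW_lub (A : Set PFN) :
    ∃ s : PFN, (∀ a ∈ A, a.leW s) ∧ ∀ u : PFN, (∀ a ∈ A, a.leW u) → s.leW u := by
  obtain ⟨s, hs, hs₁, hs₂⟩ := Real.exists_isLUB_insert (b := -1) (c := 1) (T := score '' A)
    (by norm_num) (by rintro _ ⟨a, -, rfl⟩; exact a.score_le_one)
  obtain ⟨h, hh, hh₁, hh₂⟩ := Real.exists_isLUB_insert (b := |s|) (c := 1)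
    (T := H1 '' {a ∈ A | a.score = s})
    (abs_le.2 ⟨hs₁, hs₂⟩) (by rintro _ ⟨a, -, rfl⟩; exact a.H1_le_one)
  obtain ⟨t, ht, ht₁, ht₂⟩ := Real.exists_isLUB_insert (b := h) (c := 1)
    (T := H2 '' {a ∈ A | a.score = s ∧ a.H1 = h})
    hh₂ (by rintro _ ⟨a, -, rfl⟩; exact a.H2_le_one)
  obtain ⟨m, rfl, rfl, rfl⟩ := exists_score_H1_H2 hh₁ ht₁ ht₂
  refine ⟨m, fun a ha => leW_of_le ?_ ?_ ?_, fun u hu => leW_of_le ?_ ?_ ?_⟩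
  · exact hs.1 (.inr ⟨a, ha, rfl⟩)
  · exact fun e => hh.1 (.inr ⟨a, ⟨ha, e⟩, rfl⟩)
  · exact fun e e₁ => ht.1 (.inr ⟨a, ⟨ha, e, e₁⟩, rfl⟩)
  · apply hs.2
    rintro _ (rfl | ⟨a, ha, rfl⟩)
    exacts [u.neg_one_le_score, (hu a ha).score_le]
  · intro e
    apply hh.2
    rintro _ (rfl | ⟨a, ⟨ha, ea⟩, rfl⟩)
    exacts [e ▸ u.abs_score_le_H1, (hu a ha).H1_le (ea.trans e)]
  · intro e e₁
    apply ht.2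
    rintro _ (rfl | ⟨a, ⟨ha, ea, ea₁⟩, rfl⟩)
    exacts [e₁ ▸ u.H1_le_H2, (hu a ha).H2_le (ea.trans e) (ea₁.trans e₁)]

end PFN

/-- `(𝒫, ≼_W)` is a complete lattice: every subset has a least upper bound and a greatest
lower bound, with bottom `⟨0,0,1⟩` and top `⟨1,0,0⟩`. -/
theorem leW_completeLattice :
    (∀ A : Set PFN, ∃ s : PFN, (∀ a ∈ A, a.leW s) ∧ ∀ u : PFN, (∀ a ∈ A, a.leW u) → s.leW u) ∧
    (∀ A : Set PFN, ∃ i : PFN, (∀ a ∈ A, i.leW a) ∧ ∀ l : PFN, (∀ a ∈ A, l.leW a) → l.leW i) ∧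
    (∀ a : PFN, PFN.bot.leW a) ∧
    (∀ a : PFN, a.leW PFN.top) := by
  have hsup := PFN.exists_leW_lub
  refine ⟨hsup, fun A => ?_, PFN.bot_leW, PFN.leW_top⟩
  obtain ⟨i, hi, hi'⟩ := hsup {l | ∀ a ∈ A, l.leW a}
  exact ⟨i, fun a ha => hi' a fun l hl => hl a ha, hi⟩
end

section
/- Let T be a t-norm (a commutative, associative, monotone binary operation on [0,1] with neutral element 1) and let S(u,v) = 1 − T(1−u, 1−v) be its dual t-conorm. For any two PFNs α₁ = ⟨μ₁,η₁,ν₁⟩ and α₂ = ⟨μ₂,η₂,ν₂⟩, the triple α₁ ⊕_T α₂ = ⟨S(μ₁,μ₂), T(η₁+ν₁, η₂+ν₂) − T(ν₁,ν₂), T(ν₁,ν₂)⟩ is again a PFN, i.e., all three components lie in [0,1] and their sum is at most 1. -/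
open scoped ENNReal

/-- A triangular norm on `[0,1]`, encoded as a real binary function together with the
t-norm axioms restricted to `[0,1]`. -/
structure Tnorm where
  T : ℝ → ℝ → ℝ
  mem_Icc : ∀ u v, u ∈ Set.Icc (0:ℝ) 1 → v ∈ Set.Icc (0:ℝ) 1 → T u v ∈ Set.Icc (0:ℝ) 1
  comm : ∀ u v, u ∈ Set.Icc (0:ℝ) 1 → v ∈ Set.Icc (0:ℝ) 1 → T u v = T v u
  assoc : ∀ u v w, u ∈ Set.Icc (0:ℝ) 1 → v ∈ Set.Icc (0:ℝ) 1 → w ∈ Set.Icc (0:ℝ) 1 →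
    T (T u v) w = T u (T v w)
  mono : ∀ u v w, u ∈ Set.Icc (0:ℝ) 1 → v ∈ Set.Icc (0:ℝ) 1 → w ∈ Set.Icc (0:ℝ) 1 →
    u ≤ v → T u w ≤ T v w
  neutral : ∀ u, u ∈ Set.Icc (0:ℝ) 1 → T u 1 = u

/-- The dual t-conorm `S(u,v) = 1 - T(1-u, 1-v)`. -/
def Tnorm.S (Tn : Tnorm) (u v : ℝ) : ℝ := 1 - Tn.T (1 - u) (1 - v)

/-- Interactional sum `α₁ ⊕_T α₂` of two triples. -/
def Tnorm.oplus (Tn : Tnorm) (a b : ℝ × ℝ × ℝ) : ℝ × ℝ × ℝ :=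
  (Tn.S a.1 b.1, Tn.T (a.2.1 + a.2.2) (b.2.1 + b.2.2) - Tn.T a.2.2 b.2.2, Tn.T a.2.2 b.2.2)

/-- A t-norm is monotone in both arguments jointly on `[0,1]`. -/
theorem Tnorm.mono_both (Tn : Tnorm) {u v u' v' : ℝ} (hu : u ∈ Set.Icc (0:ℝ) 1)
    (hv : v ∈ Set.Icc (0:ℝ) 1) (hu' : u' ∈ Set.Icc (0:ℝ) 1) (hv' : v' ∈ Set.Icc (0:ℝ) 1)
    (huu' : u ≤ u') (hvv' : v ≤ v') : Tn.T u v ≤ Tn.T u' v' :=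
  calc Tn.T u v ≤ Tn.T u' v := Tn.mono u u' v hu hu' hv huu'
    _ = Tn.T v u' := Tn.comm u' v hu' hv
    _ ≤ Tn.T v' u' := Tn.mono v v' u' hv hv' hu' hvv'
    _ = Tn.T u' v' := Tn.comm v' u' hv' hu'

/-- Closedness of the interactional sum `⊕_T`: for any t-norm `T` and PFNs `α₁, α₂`,
all three components of `α₁ ⊕_T α₂` lie in `[0,1]` and their sum is at most `1`. -/
theorem oplus_closed (Tn : Tnorm) (a b : PFN) :
    isPFN (Tn.oplus a.toProd b.toProd) := by
  obtain ⟨m₁, e₁, n₁, _, _, _, _, _, _, _⟩ := a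
  obtain ⟨m₂, e₂, n₂, _, _, _, _, _, _, _⟩ := b
  have hm₁ : 1 - m₁ ∈ Set.Icc (0:ℝ) 1 := ⟨by linarith, by linarith⟩
  have hm₂ : 1 - m₂ ∈ Set.Icc (0:ℝ) 1 := ⟨by linarith, by linarith⟩
  have hs₁ : e₁ + n₁ ∈ Set.Icc (0:ℝ) 1 := ⟨by linarith, by linarith⟩
  have hs₂ : e₂ + n₂ ∈ Set.Icc (0:ℝ) 1 := ⟨by linarith, by linarith⟩
  have hn₁ : n₁ ∈ Set.Icc (0:ℝ) 1 := ⟨by linarith, by linarith⟩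
  have hn₂ : n₂ ∈ Set.Icc (0:ℝ) 1 := ⟨by linarith, by linarith⟩
  have hns := Tn.mono_both hn₁ hn₂ hs₁ hs₂ (by linarith) (by linarith)
  have hsm := Tn.mono_both hs₁ hs₂ hm₁ hm₂ (by linarith) (by linarith)
  obtain ⟨_, _⟩ := Tn.mem_Icc _ _ hm₁ hm₂
  obtain ⟨_, _⟩ := Tn.mem_Icc _ _ hs₁ hs₂
  obtain ⟨_, _⟩ := Tn.mem_Icc _ _ hn₁ hn₂
  simp only [isPFN, Tnorm.oplus, Tnorm.S, PFN.toProd]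
  refine ⟨?_, ?_, ?_, ?_, ?_, ?_, ?_⟩ <;> linarith
end

section
/- Let τ : [0,1] → [0,+∞] be a continuous strictly decreasing bijection with τ(1) = 0 and τ(0) = +∞, and let ζ(u) = τ(1−u). For any PFN α = ⟨μ,η,ν⟩ and any real λ > 0, the triple α^{λ_T} = ⟨τ⁻¹(λ·τ(μ)), τ⁻¹(λ·τ(η+μ)) − τ⁻¹(λ·τ(μ)), ζ⁻¹(λ·ζ(ν))⟩ is again a PFN, i.e., all three components lie in [0,1] and their sum is at most 1. -/
open scoped ENNReal

/-- An additive generator of a strict t-norm: a continuous, strictly decreasing bijection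
`τ : [0,1] → [0,+∞]` with `τ(1) = 0` and `τ(0) = +∞`, together with its inverse. -/
structure Gen where
  tau : ℝ → ℝ≥0∞
  tauInv : ℝ≥0∞ → ℝ
  continuousOn : ContinuousOn tau (Set.Icc 0 1)
  strictAntiOn : StrictAntiOn tau (Set.Icc 0 1)
  tauInv_mem : ∀ y, tauInv y ∈ Set.Icc (0:ℝ) 1
  leftInv : ∀ x ∈ Set.Icc (0:ℝ) 1, tauInv (tau x) = x
  rightInv : ∀ y, tau (tauInv y) = y
  tau_one : tau 1 = 0
  tau_zero : tau 0 = ⊤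

/-- `ζ(u) = τ(1-u)`. -/
noncomputable def Gen.zeta (g : Gen) (u : ℝ) : ℝ≥0∞ := g.tau (1 - u)

/-- `ζ⁻¹(y) = 1 - τ⁻¹(y)`. -/
noncomputable def Gen.zetaInv (g : Gen) (y : ℝ≥0∞) : ℝ := 1 - g.tauInv y

/-- Power `α^{λ_T} = ⟨τ⁻¹(λ·τ(μ)), τ⁻¹(λ·τ(η+μ)) - τ⁻¹(λ·τ(μ)), ζ⁻¹(λ·ζ(ν))⟩`. -/
noncomputable def Gen.pow (g : Gen) (l : ℝ) (a : ℝ × ℝ × ℝ) : ℝ × ℝ × ℝ :=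
  (g.tauInv (ENNReal.ofReal l * g.tau a.1),
   g.tauInv (ENNReal.ofReal l * g.tau (a.2.1 + a.1)) -
     g.tauInv (ENNReal.ofReal l * g.tau a.1),
   g.zetaInv (ENNReal.ofReal l * g.zeta a.2.2))

theorem Gen.tauInv_antitone (g : Gen) : Antitone g.tauInv := by
  intro y z h
  rwa [← g.strictAntiOn.le_iff_ge (g.tauInv_mem y) (g.tauInv_mem z), g.rightInv, g.rightInv]

/-- The map `x ↦ τ⁻¹(c·τ(x))` is monotone on `[0,1]`. -/
theorem Gen.monotoneOn_tauInv_mul_tau (g : Gen) (c : ℝ≥0∞) :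
    MonotoneOn (fun x => g.tauInv (c * g.tau x)) (Set.Icc 0 1) := by
  intro x hx y hy h
  exact g.tauInv_antitone (by gcongr; exact g.strictAntiOn.antitoneOn hx hy h)

/-- Closedness of the power `α^{λ_T}`: for any additive generator `τ` of a strict t-norm,
PFN `α` and real `λ > 0`, all three components of `α^{λ_T}` lie in `[0,1]` and their sum
is at most `1`. -/
theorem pow_closed (g : Gen) (a : PFN) (l : ℝ) (hl : 0 < l) :
    isPFN (g.pow l a.toProd) := by
  obtain ⟨m, e, n, hm, hm1, he, he1, hn, hn1, hs⟩ := a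
  have hmono := g.monotoneOn_tauInv_mul_tau (ENNReal.ofReal l)
  have h₁ := hmono (a := m) (b := e + m) ⟨hm, hm1⟩ ⟨by linarith, by linarith⟩ (by linarith)
  have h₂ := hmono (a := e + m) (b := 1 - n) ⟨by linarith, by linarith⟩
    ⟨by linarith, by linarith⟩ (by linarith)
  obtain ⟨hp, hp1⟩ := g.tauInv_mem (ENNReal.ofReal l * g.tau m)
  obtain ⟨hq, hq1⟩ := g.tauInv_mem (ENNReal.ofReal l * g.tau (e + m))
  obtain ⟨hr, hr1⟩ := g.tauInv_mem (ENNReal.ofReal l * g.tau (1 - n))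
  simp only [isPFN, Gen.pow, PFN.toProd, Gen.zeta, Gen.zetaInv] at *
  refine ⟨?_, ?_, ?_, ?_, ?_, ?_, ?_⟩ <;> linarith
end

section
/- Let T be a t-norm with dual t-conorm S(u,v) = 1 − T(1−u,1−v). The interactional sum ⊕_T on PFNs is associative: for all PFNs α, β, γ, one has (α ⊕_T β) ⊕_T γ = α ⊕_T (β ⊕_T γ). -/
open scoped ENNReal

namespace PFN

theorem one_sub_mu_mem_Icc (a : PFN) : 1 - a.mu ∈ Set.Icc (0 : ℝ) 1 :=
  ⟨sub_nonneg.2 a.mu_le_one, sub_le_self _ a.mu_nonneg⟩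

theorem nu_mem_Icc (a : PFN) : a.nu ∈ Set.Icc (0 : ℝ) 1 :=
  ⟨a.nu_nonneg, a.nu_le_one⟩

theorem eta_add_nu_mem_Icc (a : PFN) : a.eta + a.nu ∈ Set.Icc (0 : ℝ) 1 :=
  ⟨add_nonneg a.eta_nonneg a.nu_nonneg, by linarith [a.mu_nonneg, a.sum_le_one]⟩

end PFN

/-- The interactional sum `⊕_T` is associative on PFNs. -/
theorem oplus_assoc (Tn : Tnorm) (a b c : PFN) :
    Tn.oplus (Tn.oplus a.toProd b.toProd) c.toProd =
      Tn.oplus a.toProd (Tn.oplus b.toProd c.toProd) := by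
  simp only [Tnorm.oplus, Tnorm.S, PFN.toProd, sub_sub_cancel, sub_add_cancel,
    Tn.assoc _ _ _ a.one_sub_mu_mem_Icc b.one_sub_mu_mem_Icc c.one_sub_mu_mem_Icc,
    Tn.assoc _ _ _ a.nu_mem_Icc b.nu_mem_Icc c.nu_mem_Icc,
    Tn.assoc _ _ _ a.eta_add_nu_mem_Icc b.eta_add_nu_mem_Icc c.eta_add_nu_mem_Icc]
end

section
/- Let τ : [0,1] → [0,+∞] be a continuous strictly decreasing bijection with τ(1) = 0 and τ(0) = +∞, inducing the strict t-norm T and operations ⊕_T and λ·_T on PFNs. For every PFN α and all reals ξ, λ > 0, one has (ξ·_T α) ⊕_T (λ·_T α) = (ξ + λ)·_T α. -/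
open scoped ENNReal

/-- The strict t-norm induced by the generator: `T(u,v) = τ⁻¹(τ(u) + τ(v))`. -/
noncomputable def Gen.Top (g : Gen) (u v : ℝ) : ℝ := g.tauInv (g.tau u + g.tau v)

/-- The dual t-conorm induced by the generator: `S(u,v) = ζ⁻¹(ζ(u) + ζ(v))`. -/
noncomputable def Gen.Sop (g : Gen) (u v : ℝ) : ℝ := g.zetaInv (g.zeta u + g.zeta v)

/-- Interactional sum `α₁ ⊕_T α₂` for the induced strict t-norm. -/
noncomputable def Gen.oplus (g : Gen) (a b : ℝ × ℝ × ℝ) : ℝ × ℝ × ℝ :=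
  (g.Sop a.1 b.1, g.Top (a.2.1 + a.2.2) (b.2.1 + b.2.2) - g.Top a.2.2 b.2.2,
   g.Top a.2.2 b.2.2)

/-- Scalar multiple `λ ·_T α = ⟨ζ⁻¹(λ·ζ(μ)), τ⁻¹(λ·τ(η+ν)) - τ⁻¹(λ·τ(ν)), τ⁻¹(λ·τ(ν))⟩`. -/
noncomputable def Gen.smul (g : Gen) (l : ℝ) (a : ℝ × ℝ × ℝ) : ℝ × ℝ × ℝ :=
  (g.zetaInv (ENNReal.ofReal l * g.zeta a.1),
   g.tauInv (ENNReal.ofReal l * g.tau (a.2.1 + a.2.2)) -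
     g.tauInv (ENNReal.ofReal l * g.tau a.2.2),
   g.tauInv (ENNReal.ofReal l * g.tau a.2.2))

/-- `(ξ ·_T α) ⊕_T (λ ·_T α) = (ξ + λ) ·_T α` for all reals `ξ, λ > 0` and PFNs `α`. -/
theorem smul_oplus_smul (g : Gen) (a : PFN) (ξ l : ℝ) (hξ : 0 < ξ) (hl : 0 < l) :
    g.oplus (g.smul ξ a.toProd) (g.smul l a.toProd) = g.smul (ξ + l) a.toProd := by
  simp only [Gen.oplus, Gen.smul, Gen.Sop, Gen.Top, Gen.zetaInv, Gen.zeta, sub_sub_cancel,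
    sub_add_cancel, g.rightInv, ENNReal.ofReal_add hξ.le hl.le, add_mul]
end

section
/- Let τ : [0,1] → [0,+∞] be a continuous strictly decreasing bijection with τ(1) = 0 and τ(0) = +∞, inducing the strict t-norm T and the operations ⊗_T and power α^{λ_T} on PFNs. For all PFNs α, β and every real λ > 0, one has (α ⊗_T β)^{λ_T} = (α^{λ_T}) ⊗_T (β^{λ_T}). -/
open scoped ENNReal

/-- Interactional product `α₁ ⊗_T α₂` for the induced strict t-norm. -/
noncomputable def Gen.otimes (g : Gen) (a b : ℝ × ℝ × ℝ) : ℝ × ℝ × ℝ :=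
  (g.Top a.1 b.1, g.Top (a.2.1 + a.1) (b.2.1 + b.1) - g.Top a.1 b.1,
   g.Sop a.2.2 b.2.2)

theorem Gen.zeta_zetaInv (g : Gen) (y : ℝ≥0∞) : g.zeta (g.zetaInv y) = y := by
  simp [Gen.zeta, Gen.zetaInv, g.rightInv]

/-- `(α ⊗_T β)^{λ_T} = (α^{λ_T}) ⊗_T (β^{λ_T})` for all PFNs `α, β` and reals `λ > 0`. -/
theorem pow_distrib_otimes (g : Gen) (a b : PFN) (l : ℝ) (hl : 0 < l) :
    g.pow l (g.otimes a.toProd b.toProd) =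
      g.otimes (g.pow l a.toProd) (g.pow l b.toProd) := by
  simp [Gen.pow, Gen.otimes, Gen.Top, Gen.Sop, g.rightInv, g.zeta_zetaInv, mul_add]
end

section
/- Let T be a t-norm with dual t-conorm S(u,v) = 1 − T(1−u,1−v), and for n ≥ 1 let T⁽ⁿ⁾ and S⁽ⁿ⁾ denote the n-ary extensions obtained by iterating T and S via associativity. For any PFNs αⱼ = ⟨μⱼ,ηⱼ,νⱼ⟩ (j = 1,…,n), the n-fold interactional sum satisfies α₁ ⊕_T α₂ ⊕_T ⋯ ⊕_T αₙ = ⟨S⁽ⁿ⁾(μ₁,…,μₙ), T⁽ⁿ⁾(η₁+ν₁,…,ηₙ+νₙ) − T⁽ⁿ⁾(ν₁,…,νₙ), T⁽ⁿ⁾(ν₁,…,νₙ)⟩. -/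
open scoped ENNReal

/-- `n`-ary extension of a binary operation by left-iteration:
`F⁽ⁿ⁾(z₁,…,zₙ) = F(F⁽ⁿ⁻¹⁾(z₁,…,zₙ₋₁), zₙ)`, with `F⁽¹⁾(z) = z`. -/
def iterOp {X : Type*} (F : X → X → X) : (n : ℕ) → (Fin (n + 1) → X) → X
  | 0, z => z 0
  | n + 1, z => F (iterOp F n (fun i => z i.castSucc)) (z (Fin.last (n + 1)))

/-- The `n`-fold interactional sum satisfies
`α₁ ⊕_T ⋯ ⊕_T αₙ = ⟨S⁽ⁿ⁾(μ₁,…,μₙ), T⁽ⁿ⁾(η₁+ν₁,…,ηₙ+νₙ) - T⁽ⁿ⁾(ν₁,…,νₙ), T⁽ⁿ⁾(ν₁,…,νₙ)⟩`. -/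
theorem iter_oplus_formula (Tn : Tnorm) (n : ℕ) (α : Fin (n + 1) → PFN) :
    iterOp Tn.oplus n (fun j => (α j).toProd) =
      (iterOp Tn.S n (fun j => (α j).mu),
       iterOp Tn.T n (fun j => (α j).eta + (α j).nu) - iterOp Tn.T n (fun j => (α j).nu),
       iterOp Tn.T n (fun j => (α j).nu)) := by
  induction n with
  | zero => simp [iterOp, PFN.toProd]
  | succ n ih =>
    simp only [iterOp]
    rw [ih fun i => α i.castSucc]
    simp [Tnorm.oplus, PFN.toProd]
end

section
/- Let τ : [0,1] → [0,+∞] be a continuous strictly decreasing bijection with τ(1) = 0 and τ(0) = +∞, ζ(u) = τ(1−u), and let ω = (ω₁,…,ωₙ) be a weight vector. For any PFNs αⱼ = ⟨μⱼ,ηⱼ,νⱼ⟩ (j = 1,…,n), the picture fuzzy interactional weighted average PFIWA_{T,ω}(α₁,…,αₙ) = (ω₁·_T α₁) ⊕_T ⋯ ⊕_T (ωₙ·_T αₙ) equals ⟨ζ⁻¹(Σⱼ ωⱼ·ζ(μⱼ)), τ⁻¹(Σⱼ ωⱼ·τ(ηⱼ+νⱼ)) − τ⁻¹(Σⱼ ωⱼ·τ(νⱼ)),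 τ⁻¹(Σⱼ ωⱼ·τ(νⱼ))⟩. -/
open scoped ENNReal

/-- A weight vector: all entries in `(0,1]` summing to `1`. -/
def IsWeight {n : ℕ} (ω : Fin n → ℝ) : Prop :=
  (∀ j, 0 < ω j ∧ ω j ≤ 1) ∧ ∑ j, ω j = 1

/-- Left-iterating `⊕_T` over scalar multiples adds up the generator values componentwise. -/
theorem Gen.iterOp_oplus_smul (g : Gen) (n : ℕ) (l : Fin (n + 1) → ℝ)
    (a : Fin (n + 1) → ℝ × ℝ × ℝ) :
    iterOp g.oplus n (fun j => g.smul (l j) (a j)) =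
      (g.zetaInv (∑ j, ENNReal.ofReal (l j) * g.zeta (a j).1),
       g.tauInv (∑ j, ENNReal.ofReal (l j) * g.tau ((a j).2.1 + (a j).2.2)) -
         g.tauInv (∑ j, ENNReal.ofReal (l j) * g.tau (a j).2.2),
       g.tauInv (∑ j, ENNReal.ofReal (l j) * g.tau (a j).2.2)) := by
  induction n with
  | zero => simp [iterOp, Gen.smul]
  | succ n ih =>
    rw [iterOp, ih (fun i => l i.castSucc) (fun i => a i.castSucc)]
    simp [Gen.oplus, Gen.smul, Gen.Sop, Gen.Top, Gen.zeta, Gen.zetaInv, g.rightInv,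
      Fin.sum_univ_castSucc (n := n + 1)]

/-- Closed formula for the picture fuzzy interactional weighted average operator:
`PFIWA_{T,ω}(α₁,…,αₙ) = (ω₁ ·_T α₁) ⊕_T ⋯ ⊕_T (ωₙ ·_T αₙ)` equals
`⟨ζ⁻¹(Σⱼ ωⱼ·ζ(μⱼ)), τ⁻¹(Σⱼ ωⱼ·τ(ηⱼ+νⱼ)) − τ⁻¹(Σⱼ ωⱼ·τ(νⱼ)), τ⁻¹(Σⱼ ωⱼ·τ(νⱼ))⟩`. -/
theorem PFIWA_formula (g : Gen) (n : ℕ) (ω : Fin (n + 1) → ℝ) (hω : IsWeight ω)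
    (α : Fin (n + 1) → PFN) :
    iterOp g.oplus n (fun j => g.smul (ω j) (α j).toProd) =
      (g.zetaInv (∑ j, ENNReal.ofReal (ω j) * g.zeta (α j).mu),
       g.tauInv (∑ j, ENNReal.ofReal (ω j) * g.tau ((α j).eta + (α j).nu)) -
         g.tauInv (∑ j, ENNReal.ofReal (ω j) * g.tau (α j).nu),
       g.tauInv (∑ j, ENNReal.ofReal (ω j) * g.tau (α j).nu)) :=
  g.iterOp_oplus_smul n ω fun j => (α j).toProd
end

section
/- Let τ : [0,1] → [0,+∞] be a continuous strictly decreasing bijection with τ(1) = 0 and τ(0) = +∞, ζ(u) = τ(1−u), and let ω = (ω₁,…,ωₙ) be a weight vector. For any PFNs αⱼ = ⟨μⱼ,ηⱼ,νⱼ⟩ (j = 1,…,n, n ≥ 1), the operator PFIWA_{T,ω} is bounded: ⟨min_j μⱼ, min_j ηⱼ, max_j νⱼ⟩ ≼_W PFIWA_{T,ω}(α₁,…,αₙ) ≼_W ⟨max_j μⱼ, 1 − (max_j μⱼ + min_j νⱼ), min_j νⱼ⟩, where both bounding triples are themselves PFNs. -/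
open scoped ENNReal

/-- Score function on triples. -/
def scoreP (a : ℝ × ℝ × ℝ) : ℝ := a.1 - a.2.2

/-- First accuracy function on triples. -/
def H1P (a : ℝ × ℝ × ℝ) : ℝ := a.1 + a.2.2

/-- Second accuracy function on triples. -/
def H2P (a : ℝ × ℝ × ℝ) : ℝ := a.1 + a.2.1 + a.2.2

/-- The order `≼_W` on triples. -/
def leWP (a b : ℝ × ℝ × ℝ) : Prop :=
  scoreP a < scoreP b ∨
    (scoreP a = scoreP b ∧ H1P a < H1P b) ∨
    (scoreP a = scoreP b ∧ H1P a = H1P b ∧ H2P a ≤ H2P b)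

/-- The picture fuzzy interactional weighted average operator `PFIWA_{T,ω}` (closed form). -/
noncomputable def PFIWA (g : Gen) {n : ℕ} (ω : Fin n → ℝ) (a : Fin n → ℝ × ℝ × ℝ) :
    ℝ × ℝ × ℝ :=
  (g.zetaInv (∑ j, ENNReal.ofReal (ω j) * g.zeta (a j).1),
   g.tauInv (∑ j, ENNReal.ofReal (ω j) * g.tau ((a j).2.1 + (a j).2.2)) -
     g.tauInv (∑ j, ENNReal.ofReal (ω j) * g.tau (a j).2.2),
   g.tauInv (∑ j, ENNReal.ofReal (ω j) * g.tau (a j).2.2))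

/-- The quasi-arithmetic mean with generator `τ` and weights `ω`. -/
noncomputable def Gen.mean (g : Gen) {n : ℕ} (ω : Fin n → ℝ) (x : Fin n → ℝ) : ℝ :=
  g.tauInv (∑ j, ENNReal.ofReal (ω j) * g.tau (x j))

theorem Gen.mean_mono (g : Gen) {n : ℕ} (ω : Fin n → ℝ) {x y : Fin n → ℝ}
    (hx : ∀ j, x j ∈ Set.Icc (0 : ℝ) 1) (hy : ∀ j, y j ∈ Set.Icc (0 : ℝ) 1)
    (hxy : ∀ j, x j ≤ y j) : g.mean ω x ≤ g.mean ω y := by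
  refine g.tauInv_antitone (Finset.sum_le_sum fun j _ => ?_)
  gcongr
  exact g.strictAntiOn.antitoneOn (hx j) (hy j) (hxy j)

theorem IsWeight.sum_ofReal_mul {n : ℕ} {ω : Fin n → ℝ} (hω : IsWeight ω) (c : ℝ≥0∞) :
    ∑ j, ENNReal.ofReal (ω j) * c = c := by
  rw [← Finset.sum_mul, ← ENNReal.ofReal_sum_of_nonneg fun j _ => (hω.1 j).1.le, hω.2,
    ENNReal.ofReal_one, one_mul]

theorem Gen.mean_const (g : Gen) {n : ℕ} {ω : Fin n → ℝ} (hω : IsWeight ω) {c : ℝ}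
    (hc : c ∈ Set.Icc (0 : ℝ) 1) : g.mean ω (fun _ => c) = c := by
  rw [Gen.mean, hω.sum_ofReal_mul, g.leftInv c hc]

/-- The mean attains an upper bound of its arguments only if all of them attain it. -/
theorem Gen.eq_of_mean_eq (g : Gen) {n : ℕ} {ω : Fin n → ℝ} (hω : IsWeight ω)
    {x : Fin n → ℝ} {M : ℝ} (hx : ∀ j, x j ∈ Set.Icc (0 : ℝ) 1) (hM : M ∈ Set.Icc (0 : ℝ) 1)
    (hxM : ∀ j, x j ≤ M) (h : g.mean ω x = M) (i : Fin n) : x i = M := by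
  by_contra hne
  have hlt : x i < M := lt_of_le_of_ne (hxM i) hne
  have hτ : g.tau M < g.tau (x i) := g.strictAntiOn (hx i) hM hlt
  have hsum : ∑ j, ENNReal.ofReal (ω j) * g.tau (x j) = ∑ j, ENNReal.ofReal (ω j) * g.tau M := by
    rw [hω.sum_ofReal_mul, ← h, Gen.mean, g.rightInv]
  have hterm : ENNReal.ofReal (ω i) * g.tau M < ENNReal.ofReal (ω i) * g.tau (x i) :=
    (ENNReal.mul_lt_mul_iff_right (ENNReal.ofReal_pos.2 (hω.1 i).1).ne'
      ENNReal.ofReal_ne_top).2 hτ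
  have hrest : ∑ j ∈ Finset.univ.erase i, ENNReal.ofReal (ω j) * g.tau M ≤
      ∑ j ∈ Finset.univ.erase i, ENNReal.ofReal (ω j) * g.tau (x j) := by
    refine Finset.sum_le_sum fun j _ => ?_
    gcongr
    exact g.strictAntiOn.antitoneOn (hx j) hM (hxM j)
  have hfin : ∑ j ∈ Finset.univ.erase i, ENNReal.ofReal (ω j) * g.tau M ≠ ⊤ :=
    ENNReal.sum_ne_top.2 fun j _ => ENNReal.mul_ne_top ENNReal.ofReal_ne_top hτ.ne_top
  have := ENNReal.add_lt_add_of_lt_of_le hfin hterm hrest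
  rw [Finset.add_sum_erase _ (fun j => ENNReal.ofReal (ω j) * g.tau M) (Finset.mem_univ i),
    Finset.add_sum_erase _ (fun j => ENNReal.ofReal (ω j) * g.tau (x j)) (Finset.mem_univ i),
    hsum] at this
  exact this.false

theorem PFIWA_eq_mean (g : Gen) {n : ℕ} (ω : Fin n → ℝ) (a : Fin n → PFN) :
    PFIWA g ω (fun j => (a j).toProd) =
      (1 - g.mean ω (fun j => 1 - (a j).mu),
       g.mean ω (fun j => (a j).eta + (a j).nu) - g.mean ω (fun j => (a j).nu),
       g.mean ω (fun j => (a j).nu)) := rfl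

/-- For triples with ordered outer components, `≼_W` only needs a comparison of the middle
components when the outer ones agree. -/
theorem leWP_of_le {a b : ℝ × ℝ × ℝ} (h₁ : a.1 ≤ b.1) (h₃ : b.2.2 ≤ a.2.2)
    (h₂ : a.1 = b.1 → a.2.2 = b.2.2 → a.2.1 ≤ b.2.1) : leWP a b := by
  unfold leWP scoreP H1P H2P
  rcases h₁.lt_or_eq with h | h
  · left; linarith
  rcases h₃.lt_or_eq with h' | h'
  · left; linarith
  have := h₂ h h'.symm
  exact Or.inr (Or.inr ⟨by linarith, by linarith, by linarith⟩)

/-- Boundedness of `PFIWA_{T,ω}`: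
`⟨min μⱼ, min ηⱼ, max νⱼ⟩ ≼_W PFIWA_{T,ω}(α₁,…,αₙ)
  ≼_W ⟨max μⱼ, 1 − (max μⱼ + min νⱼ), min νⱼ⟩`,
and both bounding triples are themselves PFNs. -/
theorem PFIWA_bounded (g : Gen) (n : ℕ) (ω : Fin (n + 1) → ℝ) (hω : IsWeight ω)
    (α : Fin (n + 1) → PFN) :
    isPFN (Finset.univ.inf' Finset.univ_nonempty (fun j => (α j).mu),
           Finset.univ.inf' Finset.univ_nonempty (fun j => (α j).eta),
           Finset.univ.sup' Finset.univ_nonempty (fun j => (α j).nu)) ∧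
    isPFN (Finset.univ.sup' Finset.univ_nonempty (fun j => (α j).mu),
           1 - (Finset.univ.sup' Finset.univ_nonempty (fun j => (α j).mu) +
                Finset.univ.inf' Finset.univ_nonempty (fun j => (α j).nu)),
           Finset.univ.inf' Finset.univ_nonempty (fun j => (α j).nu)) ∧
    leWP (Finset.univ.inf' Finset.univ_nonempty (fun j => (α j).mu),
          Finset.univ.inf' Finset.univ_nonempty (fun j => (α j).eta),
          Finset.univ.sup' Finset.univ_nonempty (fun j => (α j).nu))
      (PFIWA g ω (fun j => (α j).toProd)) ∧
    leWP (PFIWA g ω (fun j => (α j).toProd))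
      (Finset.univ.sup' Finset.univ_nonempty (fun j => (α j).mu),
       1 - (Finset.univ.sup' Finset.univ_nonempty (fun j => (α j).mu) +
            Finset.univ.inf' Finset.univ_nonempty (fun j => (α j).nu)),
       Finset.univ.inf' Finset.univ_nonempty (fun j => (α j).nu)) := by
  rw [PFIWA_eq_mean]
  set m := Finset.univ.inf' Finset.univ_nonempty (fun j => (α j).mu)
  set e := Finset.univ.inf' Finset.univ_nonempty (fun j => (α j).eta)
  set N := Finset.univ.sup' Finset.univ_nonempty (fun j => (α j).nu)
  set M := Finset.univ.sup' Finset.univ_nonempty (fun j => (α j).mu)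
  set k := Finset.univ.inf' Finset.univ_nonempty (fun j => (α j).nu)
  have hm : ∀ j, m ≤ (α j).mu := fun j =>
    Finset.inf'_le (fun j => (α j).mu) (Finset.mem_univ j)
  have he : ∀ j, e ≤ (α j).eta := fun j =>
    Finset.inf'_le (fun j => (α j).eta) (Finset.mem_univ j)
  have hk : ∀ j, k ≤ (α j).nu := fun j =>
    Finset.inf'_le (fun j => (α j).nu) (Finset.mem_univ j)
  have hN : ∀ j, (α j).nu ≤ N := fun j =>
    Finset.le_sup' (fun j => (α j).nu) (Finset.mem_univ j)
  have hM : ∀ j, (α j).mu ≤ M := fun j =>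
    Finset.le_sup' (fun j => (α j).mu) (Finset.mem_univ j)
  have hm0 : 0 ≤ m := Finset.le_inf' _ _ fun j _ => (α j).mu_nonneg
  have he0 : 0 ≤ e := Finset.le_inf' _ _ fun j _ => (α j).eta_nonneg
  have hk0 : 0 ≤ k := Finset.le_inf' _ _ fun j _ => (α j).nu_nonneg
  obtain ⟨p, -, hp⟩ := Finset.exists_mem_eq_sup' Finset.univ_nonempty (fun j => (α j).nu)
  obtain ⟨q, -, hq⟩ := Finset.exists_mem_eq_sup' Finset.univ_nonempty (fun j => (α j).mu)
  change N = (α p).nu at hp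
  change M = (α q).mu at hq
  have hmeN : m + e + N ≤ 1 := by linarith [hm p, he p, (α p).sum_le_one]
  have hMk : M + k ≤ 1 := by linarith [hk q, (α q).sum_le_one, (α q).eta_nonneg]
  have hN0 : 0 ≤ N := hp ▸ (α p).nu_nonneg
  have hM0 : 0 ≤ M := hq ▸ (α q).mu_nonneg
  have hν : ∀ j, (α j).nu ∈ Set.Icc (0 : ℝ) 1 := fun j => ⟨(α j).nu_nonneg, (α j).nu_le_one⟩
  have hμ : ∀ j, 1 - (α j).mu ∈ Set.Icc (0 : ℝ) 1 := fun j =>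
    ⟨by linarith [(α j).mu_le_one], by linarith [(α j).mu_nonneg]⟩
  have hην : ∀ j, (α j).eta + (α j).nu ∈ Set.Icc (0 : ℝ) 1 := fun j =>
    ⟨by linarith [(α j).eta_nonneg, (α j).nu_nonneg],
      by linarith [(α j).sum_le_one, (α j).mu_nonneg]⟩
  have hNI : N ∈ Set.Icc (0 : ℝ) 1 := ⟨hN0, by linarith⟩
  have mean_le {x : Fin (n + 1) → ℝ} {c : ℝ} (hx : ∀ j, x j ∈ Set.Icc (0 : ℝ) 1)
      (hc : c ∈ Set.Icc (0 : ℝ) 1) (h : ∀ j, x j ≤ c) : g.mean ω x ≤ c :=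
    (g.mean_mono ω hx (fun _ => hc) h).trans_eq (g.mean_const hω hc)
  have le_mean {x : Fin (n + 1) → ℝ} {c : ℝ} (hx : ∀ j, x j ∈ Set.Icc (0 : ℝ) 1)
      (hc : c ∈ Set.Icc (0 : ℝ) 1) (h : ∀ j, c ≤ x j) : c ≤ g.mean ω x :=
    (g.mean_const hω hc).symm.trans_le (g.mean_mono ω (fun _ => hc) hx h)
  refine ⟨⟨hm0, by linarith, he0, by linarith, hN0, by linarith, hmeN⟩,
    ⟨hM0, by linarith, by linarith, by linarith, hk0, by linarith, by linarith⟩,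
    leWP_of_le ?_ (mean_le hν hNI hN) ?_,
    leWP_of_le ?_ (le_mean hν ⟨hk0, by linarith⟩ hk) ?_⟩
  · have := mean_le (c := 1 - m) hμ ⟨by linarith, by linarith⟩ fun j => by linarith [hm j]
    linarith
  · intro _ h
    have hall := g.eq_of_mean_eq hω hν hNI hN h.symm
    have := le_mean (c := e + N) hην ⟨by linarith, by linarith⟩
      fun j => by linarith [he j, hall j]
    linarith
  · have := le_mean (c := 1 - M) hμ ⟨by linarith, by linarith⟩ fun j => by linarith [hM j]
    linarith
  · intro h h'
    have := g.mean_mono ω hην hμ fun j => by linarith [(α j).sum_le_one]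
    dsimp only at h h' ⊢
    linarith
end

section
/- Let τ : [0,1] → [0,+∞] be a continuous strictly decreasing bijection with τ(1) = 0 and τ(0) = +∞, ζ(u) = τ(1−u), and let ω = (ω₁,…,ωₙ) be a weight vector. The operator PFIWA_{T,ω} is shift-invariant: for any PFNs α₁,…,αₙ and any PFN β, PFIWA_{T,ω}(α₁ ⊕_T β, α₂ ⊕_T β, …, αₙ ⊕_T β) = PFIWA_{T,ω}(α₁,…,αₙ) ⊕_T β. -/
open scoped ENNReal

/-- With weights summing to `1`, a constant shift passes through a weighted sum in `ℝ≥0∞`. -/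
theorem IsWeight.sum_mul_add_const {n : ℕ} {ω : Fin n → ℝ} (hω : IsWeight ω)
    (x : Fin n → ℝ≥0∞) (c : ℝ≥0∞) :
    ∑ j, ENNReal.ofReal (ω j) * (x j + c) = (∑ j, ENNReal.ofReal (ω j) * x j) + c := by
  have hsum : ∑ j, ENNReal.ofReal (ω j) = 1 := by
    rw [← ENNReal.ofReal_sum_of_nonneg fun j _ => (hω.1 j).1.le, hω.2, ENNReal.ofReal_one]
  simp_rw [mul_add, Finset.sum_add_distrib, ← Finset.sum_mul, hsum, one_mul]

/-- Shift invariance of `PFIWA_{T,ω}`: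
`PFIWA_{T,ω}(α₁ ⊕_T β, …, αₙ ⊕_T β) = PFIWA_{T,ω}(α₁,…,αₙ) ⊕_T β`. -/
theorem PFIWA_shift_invariant (g : Gen) (n : ℕ) (ω : Fin n → ℝ) (hω : IsWeight ω)
    (α : Fin n → PFN) (β : PFN) :
    PFIWA g ω (fun j => g.oplus (α j).toProd β.toProd) =
      g.oplus (PFIWA g ω (fun j => (α j).toProd)) β.toProd := by
  simp [PFIWA, Gen.oplus, Gen.Sop, Gen.Top, Gen.zeta, Gen.zetaInv, g.rightInv,
    hω.sum_mul_add_const]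
end

section
/- Let τ : [0,1] → [0,+∞] be a continuous strictly decreasing bijection with τ(1) = 0 and τ(0) = +∞, ζ(u) = τ(1−u), and let ω = (ω₁,…,ωₙ) be a weight vector. The operator PFIWA_{T,ω} is homogeneous: for any PFNs α₁,…,αₙ and any real λ > 0, PFIWA_{T,ω}(λ·_T α₁, …, λ·_T αₙ) = λ·_T PFIWA_{T,ω}(α₁,…,αₙ). -/
open scoped ENNReal

/-- Scaling by a common factor commutes with weighted sums in `[0,+∞]`. -/
theorem ENNReal.sum_mul_left_comm {ι : Type*} (s : Finset ι) (c : ℝ≥0∞) (w f : ι → ℝ≥0∞) :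
    ∑ j ∈ s, w j * (c * f j) = c * ∑ j ∈ s, w j * f j := by
  simp only [Finset.mul_sum, mul_left_comm]

/-- Homogeneity of `PFIWA_{T,ω}`:
`PFIWA_{T,ω}(λ ·_T α₁, …, λ ·_T αₙ) = λ ·_T PFIWA_{T,ω}(α₁,…,αₙ)` for any `λ > 0`. -/
theorem PFIWA_homogeneous (g : Gen) (n : ℕ) (ω : Fin n → ℝ) (hω : IsWeight ω)
    (α : Fin n → PFN) (l : ℝ) (hl : 0 < l) :
    PFIWA g ω (fun j => g.smul l (α j).toProd) =
      g.smul l (PFIWA g ω (fun j => (α j).toProd)) := by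
  simp only [PFIWA, Gen.smul, Gen.zeta_zetaInv, sub_add_cancel, g.rightInv,
    ENNReal.sum_mul_left_comm]
end
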